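/- arXiv:1411.4750 — 4 statements merged into one kernel-verified Lean document; each statement's English description precedes it below -/
import Mathlib

section
/- Let Z_0 and Z_1 be independent standard normal random variables. Then for every u ∈ ℝ: P( Z_0 + |Z_1| ≤ u ) = Φ(u/√2)². -/
open MeasureTheory ProbabilityTheory
open scoped ProbabilityTheory

/-- The standard normal cumulative distribution function. -/
noncomputable def Phi (x : ℝ) : ℝ :=
  ∫ t in Set.Iic x, (Real.sqrt (2 * Real.pi))⁻¹ * Real.exp (-t ^ 2 / 2)

lemma gaussianReal_Iic_toReal (x : ℝ) : (gaussianReal 0 1 (Set.Iic x)).toReal = Phi x := by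
  rw [gaussianReal_apply_eq_integral 0 one_ne_zero, ENNReal.toReal_ofReal
    (integral_nonneg fun _ ↦ gaussianPDFReal_nonneg _ _ _)]
  simp [gaussianPDFReal, Phi]

lemma rotation_neg_pi_div_four_preimage_Iic_prod_Iic (u : ℝ) :
    ContinuousLinearMap.rotation (-(Real.pi / 4)) ⁻¹'
      (Set.Iic (u / Real.sqrt 2) ×ˢ Set.Iic (u / Real.sqrt 2)) =
      {p : ℝ × ℝ | p.1 + |p.2| ≤ u} := by
  have hc : Real.sqrt 2 / 2 = 1 / Real.sqrt 2 := by
    rw [Real.sqrt_div_self']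
  have key (a : ℝ) : 1 / Real.sqrt 2 * a ≤ u / Real.sqrt 2 ↔ a ≤ u := by
    rw [one_div_mul_eq_div, div_le_div_iff_of_pos_right (by positivity)]
  ext ⟨x, y⟩
  simp only [Set.mem_preimage, ContinuousLinearMap.rotation_apply, Real.cos_neg, Real.sin_neg,
    Real.cos_pi_div_four, Real.sin_pi_div_four, hc, neg_neg, smul_eq_mul, Set.mem_prod,
    Set.mem_Iic, Set.mem_ofPred_eq, neg_mul, ← mul_neg, ← mul_add, key]
  rw [← le_sub_iff_add_le' (b := |y|), abs_le']
  constructor <;> rintro ⟨h₁, h₂⟩ <;> constructor <;> linarith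

lemma gaussianReal_prod_add_abs_le (u : ℝ) :
    (gaussianReal 0 1).prod (gaussianReal 0 1) {p : ℝ × ℝ | p.1 + |p.2| ≤ u} =
      gaussianReal 0 1 (Set.Iic (u / Real.sqrt 2)) ^ 2 := by
  rw [← rotation_neg_pi_div_four_preimage_Iic_prod_Iic, ← Measure.map_apply
    (ContinuousLinearMap.continuous _).measurable (measurableSet_Iic.prod measurableSet_Iic),
    IsGaussian.map_rotation_eq_self (by simp), Measure.prod_prod, sq]

/-- The cdf of `Z₀ + |Z₁|` for independent standard normals. -/
theorem stmt_5 {Ω : Type*} [MeasureSpace Ω] [IsProbabilityMeasure (ℙ : Measure Ω)]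
    (Z₀ Z₁ : Ω → ℝ) (hZ₀ : Measurable Z₀) (hZ₁ : Measurable Z₁)
    (hindep : IndepFun Z₀ Z₁ ℙ)
    (hZ₀law : Measure.map Z₀ ℙ = gaussianReal 0 1)
    (hZ₁law : Measure.map Z₁ ℙ = gaussianReal 0 1)
    (u : ℝ) :
    (ℙ {ω | Z₀ ω + |Z₁ ω| ≤ u}).toReal = (Phi (u / Real.sqrt 2)) ^ 2 := by
  have hlaw := hindep.map_prod_eq_prod_map_map hZ₀.aemeasurable hZ₁.aemeasurable
  rw [hZ₀law, hZ₁law] at hlaw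
  rw [← gaussianReal_Iic_toReal, ← ENNReal.toReal_pow, ← gaussianReal_prod_add_abs_le, ← hlaw,
    Measure.map_apply (hZ₀.prodMk hZ₁) (measurableSet_le (by fun_prop) measurable_const)]
  rfl
end

section
/- Let Z_0 and Z_1 be independent standard normal random variables. Then lim_{u→∞} P( |Z_0| + |Z_1| > u ) / ( 4 (1 − Φ(u/√2)) ) = 1. -/
open MeasureTheory ProbabilityTheory Filter
open scoped ProbabilityTheory

/-- `Phi` is the cumulative distribution function of the standard Gaussian measure. -/
lemma Phi_eq_cdf (x : ℝ) : Phi x = cdf (gaussianReal 0 1) x := by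
  rw [cdf_eq_real, measureReal_def, gaussianReal_apply_eq_integral 0 one_ne_zero,
    ENNReal.toReal_ofReal (integral_nonneg fun t ↦ gaussianPDFReal_nonneg 0 1 t), Phi]
  simp [gaussianPDFReal_def]

lemma gaussianReal_real_Ioi (x : ℝ) : (gaussianReal 0 1).real (Set.Ioi x) = 1 - Phi x := by
  rw [Phi_eq_cdf, cdf_eq_real, ← Set.compl_Iic, probReal_compl_eq_one_sub measurableSet_Iic]

lemma one_sub_Phi_pos (x : ℝ) : 0 < 1 - Phi x := by
  rw [← gaussianReal_real_Ioi, measureReal_def]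
  refine ENNReal.toReal_pos (fun h ↦ ?_) (measure_ne_top _ _)
  simpa using gaussianReal_absolutelyContinuous' 0 one_ne_zero h

lemma gaussianReal_real_Iio_neg (x : ℝ) :
    (gaussianReal 0 1).real (Set.Iio (-x)) = 1 - Phi x := by
  have h := gaussianReal_map_neg (μ := 0) (v := 1)
  rw [neg_zero] at h
  rw [← gaussianReal_real_Ioi]
  conv_rhs => rw [← h]
  rw [map_measureReal_apply measurable_neg measurableSet_Ioi]
  congr 1
  ext y
  simp

/-- The two-sided tail of the standard Gaussian measure. -/
lemma gaussianReal_real_lt_abs {x : ℝ} (hx : 0 ≤ x) :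
    (gaussianReal 0 1).real {y | x < |y|} = 2 * (1 - Phi x) := by
  have hset : {y : ℝ | x < |y|} = Set.Ioi x ∪ Set.Iio (-x) := by
    ext y
    simp [lt_abs, lt_neg]
  rw [hset, measureReal_union _ measurableSet_Iio, gaussianReal_real_Ioi,
    gaussianReal_real_Iio_neg, two_mul]
  rw [Set.disjoint_left]
  intro y hy hy'
  simp only [Set.mem_Ioi, Set.mem_Iio] at hy hy'
  linarith

lemma tendsto_Phi_atTop : Tendsto Phi atTop (nhds 1) := by
  rw [funext Phi_eq_cdf]
  exact tendsto_cdf_atTop _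

section Rotation

variable {Ω : Type*} {mΩ : MeasurableSpace Ω} {P : Measure Ω}
  {X Y : Ω → ℝ}

/-- The sum of two independent standard Gaussians, divided by `√2`, is standard Gaussian. -/
lemma map_add_div_sqrt_two_eq_gaussianReal (hX : AEMeasurable X P) (hY : AEMeasurable Y P)
    (h : IndepFun X Y P) (hXlaw : P.map X = gaussianReal 0 1)
    (hYlaw : P.map Y = gaussianReal 0 1) :
    P.map (fun ω ↦ (X ω + Y ω) / √2) = gaussianReal 0 1 := by
  have hadd := gaussianReal_add_gaussianReal_of_indepFun h hXlaw hYlaw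
  have hcomp : (fun ω ↦ (X ω + Y ω) / √2) = (· / √2) ∘ (X + Y) := rfl
  rw [hcomp, ← AEMeasurable.map_map_of_aemeasurable (by fun_prop) (hX.add hY), hadd,
    gaussianReal_map_div_const]
  congr 1
  · simp
  · ext
    norm_num

/-- The sum and the difference of two independent standard Gaussians are independent. -/
lemma indepFun_add_sub_of_gaussianReal [IsProbabilityMeasure P] (h : IndepFun X Y P)
    (hXlaw : P.map X = gaussianReal 0 1) (hYlaw : P.map Y = gaussianReal 0 1) :
    IndepFun (X + Y) (X - Y) P := by
  have hXg : HasGaussianLaw X P := ⟨by rw [hXlaw]; infer_instance⟩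
  have hYg : HasGaussianLaw Y P := ⟨by rw [hYlaw]; infer_instance⟩
  have hXY : HasGaussianLaw (fun ω ↦ (X ω, Y ω)) P := h.hasGaussianLaw hXg hYg
  have hpair : HasGaussianLaw (fun ω ↦ ((X + Y) ω, (X - Y) ω)) P :=
    hXY.map_fun ((ContinuousLinearMap.fst ℝ ℝ ℝ + ContinuousLinearMap.snd ℝ ℝ ℝ).prod
      (ContinuousLinearMap.fst ℝ ℝ ℝ - ContinuousLinearMap.snd ℝ ℝ ℝ))
  have hvar : Var[X; P] = Var[Y; P] := by
    rw [← variance_id_map hXg.aemeasurable, ← variance_id_map hYg.aemeasurable, hXlaw, hYlaw]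
  refine hpair.indepFun_of_covariance_eq_zero ?_
  have hX2 := hXg.memLp_two
  have hY2 := hYg.memLp_two
  rw [covariance_add_left hX2 hY2 (hX2.sub hY2), covariance_sub_right hX2 hX2 hY2,
    covariance_sub_right hY2 hX2 hY2, covariance_self hXg.aemeasurable,
    covariance_self hYg.aemeasurable, covariance_comm Y X, hvar]
  ring

/-- The tail of `|X| + |Y|` for independent standard Gaussians `X` and `Y`. -/
lemma measureReal_lt_abs_add_abs [IsProbabilityMeasure P] (hX : Measurable X) (hY : Measurable Y)
    (h : IndepFun X Y P) (hXlaw : P.map X = gaussianReal 0 1)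
    (hYlaw : P.map Y = gaussianReal 0 1) {u : ℝ} (hu : 0 ≤ u) :
    P.real {ω | u < |X ω| + |Y ω|} = 4 * (1 - Phi (u / √2)) * Phi (u / √2) := by
  have hs : 0 < √(2 : ℝ) := by positivity
  set S : Ω → ℝ := fun ω ↦ (X ω + Y ω) / √2 with hS
  set D : Ω → ℝ := fun ω ↦ (X ω - Y ω) / √2 with hD
  set A : Set ℝ := {y | u / √2 < |y|} with hA
  have hSm : Measurable S := by fun_prop
  have hDm : Measurable D := by fun_prop
  have hAm : MeasurableSet A := measurableSet_lt measurable_const measurable_id.abs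
  have hYneg : P.map (-Y) = gaussianReal 0 1 := by
    have hcomp : -Y = (fun y ↦ -y) ∘ Y := rfl
    rw [hcomp, ← Measure.map_map measurable_neg hY, hYlaw, gaussianReal_map_neg, neg_zero]
  have hSlaw : P.map S = gaussianReal 0 1 :=
    map_add_div_sqrt_two_eq_gaussianReal hX.aemeasurable hY.aemeasurable h hXlaw hYlaw
  have hDlaw : P.map D = gaussianReal 0 1 := by
    simpa [hD, sub_eq_add_neg] using map_add_div_sqrt_two_eq_gaussianReal hX.aemeasurable
      hY.neg.aemeasurable (h.comp measurable_id measurable_neg) hXlaw hYneg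
  have hSD : IndepFun S D P :=
    (indepFun_add_sub_of_gaussianReal h hXlaw hYlaw).comp
      (measurable_id.div_const (√2)) (measurable_id.div_const (√2))
  have hset : {ω | u < |X ω| + |Y ω|} = S ⁻¹' A ∪ D ⁻¹' A := by
    ext ω
    simp only [Set.mem_ofPred_eq, Set.mem_union, Set.mem_preimage, hA, hS, hD, abs_div,
      abs_of_pos hs, div_lt_div_iff_of_pos_right hs, ← lt_max_iff]
    congr! 1
    grind
  have hp : 0 ≤ u / √2 := by positivity
  have hSA : P.real (S ⁻¹' A) = 2 * (1 - Phi (u / √2)) := by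
    rw [← map_measureReal_apply hSm hAm, hSlaw, gaussianReal_real_lt_abs hp]
  have hDA : P.real (D ⁻¹' A) = 2 * (1 - Phi (u / √2)) := by
    rw [← map_measureReal_apply hDm hAm, hDlaw, gaussianReal_real_lt_abs hp]
  have hinter : P.real (S ⁻¹' A ∩ D ⁻¹' A) = P.real (S ⁻¹' A) * P.real (D ⁻¹' A) := by
    simp only [measureReal_def, hSD.measure_inter_preimage_eq_mul A A hAm hAm,
      ENNReal.toReal_mul]
  have hunion := measureReal_union_add_inter (μ := P) (s := S ⁻¹' A) (hDm hAm)
  rw [hset]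
  rw [hinter, hSA, hDA] at hunion
  linarith

end Rotation

/-- Tail asymptotics of `|Z₀| + |Z₁|` for independent standard normals. -/
theorem stmt_9 {Ω : Type*} [MeasureSpace Ω] [IsProbabilityMeasure (ℙ : Measure Ω)]
    (Z₀ Z₁ : Ω → ℝ) (hZ₀ : Measurable Z₀) (hZ₁ : Measurable Z₁)
    (hindep : IndepFun Z₀ Z₁ ℙ)
    (hZ₀law : Measure.map Z₀ ℙ = gaussianReal 0 1)
    (hZ₁law : Measure.map Z₁ ℙ = gaussianReal 0 1) :
    Tendsto (fun u : ℝ =>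
        (ℙ {ω | u < |Z₀ ω| + |Z₁ ω|}).toReal / (4 * (1 - Phi (u / Real.sqrt 2))))
      atTop (nhds 1) := by
  have hlim : Tendsto (fun u : ℝ ↦ Phi (u / √2)) atTop (nhds 1) :=
    tendsto_Phi_atTop.comp (tendsto_id.atTop_div_const (by positivity))
  refine hlim.congr' ?_
  filter_upwards [eventually_ge_atTop 0] with u hu
  have htail := measureReal_lt_abs_add_abs hZ₀ hZ₁ hindep hZ₀law hZ₁law hu
  have hpos := one_sub_Phi_pos (u / √2)
  rw [measureReal_def] at htail
  rw [htail]
  field_simp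
end

section
/- For every natural number n and every x ∈ [−1, 1], the Legendre polynomial satisfies |P_n(x)| ≤ 1. Moreover, for every n ≥ 1 and every x with |x| < 1, the inequality is strict: |P_n(x)| < 1. -/
/-- The `n`-th Legendre polynomial, given by Rodrigues' formula. -/
noncomputable def legendreP (n : ℕ) (x : ℝ) : ℝ :=
  (1 / (2 ^ n * n.factorial : ℝ)) * iteratedDeriv n (fun t : ℝ => (t ^ 2 - 1) ^ n) x

open Polynomial in
/-- The `n`-th Legendre polynomial without its normalizing factor `1 / (2 ^ n * n!)`. -/
noncomputable def legendreNumerator (n : ℕ) : ℝ[X] :=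
  derivative^[n] ((X ^ 2 - 1) ^ n)

open Polynomial in
theorem Polynomial.iteratedDeriv_eval (p : ℝ[X]) (n : ℕ) (x : ℝ) :
    iteratedDeriv n (fun t => p.eval t) x = (derivative^[n] p).eval x := by
  induction n generalizing x with
  | zero => simp
  | succ n ih =>
    rw [iteratedDeriv_succ, _root_.funext ih, Polynomial.deriv, Function.iterate_succ_apply']

theorem legendreP_eq_eval (n : ℕ) (x : ℝ) :
    legendreP n x = (legendreNumerator n).eval x / (2 ^ n * n.factorial) := by
  have h := Polynomial.iteratedDeriv_eval ((Polynomial.X ^ 2 - 1) ^ n) n x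
  simp only [Polynomial.eval_pow, Polynomial.eval_sub, Polynomial.eval_X,
    Polynomial.eval_one] at h
  rw [legendreP, h, legendreNumerator]
  ring

open Polynomial in
theorem iterate_derivative_X_sq_sub_one_pow (n k : ℕ) :
    (X ^ 2 - 1) * derivative^[k + 2] ((X ^ 2 - 1 : ℝ[X]) ^ n)
      + 2 * ((k : ℝ[X]) + 1) * X * derivative^[k + 1] ((X ^ 2 - 1 : ℝ[X]) ^ n)
      + (k : ℝ[X]) * ((k : ℝ[X]) + 1) * derivative^[k] ((X ^ 2 - 1 : ℝ[X]) ^ n)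
    = 2 * (n : ℝ[X]) * X * derivative^[k + 1] ((X ^ 2 - 1 : ℝ[X]) ^ n)
      + 2 * (n : ℝ[X]) * ((k : ℝ[X]) + 1) * derivative^[k] ((X ^ 2 - 1 : ℝ[X]) ^ n) := by
  induction k with
  | zero =>
    have h : (X ^ 2 - 1) * derivative ((X ^ 2 - 1 : ℝ[X]) ^ n)
        = 2 * (n : ℝ[X]) * X * (X ^ 2 - 1) ^ n := by
      cases n with
      | zero => simp
      | succ m =>
        simp [derivative_pow, derivative_X, map_ofNat]
        ring
    have h' := congrArg derivative h
    generalize (X ^ 2 - 1 : ℝ[X]) ^ n = u at h' ⊢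
    simp [derivative_mul, derivative_X] at h' ⊢
    linear_combination h'
  | succ k ih =>
    have h := congrArg derivative ih
    generalize (X ^ 2 - 1 : ℝ[X]) ^ n = u at h ⊢
    simp only [Function.iterate_succ_apply'] at h ⊢
    simp [derivative_mul, derivative_X] at h ⊢
    linear_combination h

open Polynomial in
/-- Legendre's differential equation. -/
theorem legendreNumerator_ode (n : ℕ) :
    (X ^ 2 - 1) * derivative (derivative (legendreNumerator n))
      + 2 * X * derivative (legendreNumerator n) = (n : ℝ[X]) * ((n : ℝ[X]) + 1) * legendreNumerator n := by
  have h := iterate_derivative_X_sq_sub_one_pow n n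
  simp only [Function.iterate_succ_apply'] at h
  rw [legendreNumerator]
  linear_combination h

open Polynomial in
theorem legendreNumerator_eval_of_sq_eq_one (n : ℕ) {a : ℝ} (ha : a ^ 2 = 1) :
    (legendreNumerator n).eval a = n.factorial * (2 * a) ^ n := by
  have h : taylor a ((X ^ 2 - 1) ^ n) = (X + C (2 * a)) ^ n * X ^ n := by
    rw [← mul_pow, taylor_apply]
    simp only [pow_comp, sub_comp, X_comp, one_comp]
    congr 1
    have hC : (C a : ℝ[X]) ^ 2 = 1 := by rw [← C_pow, ha, C_1]
    rw [C_mul, map_ofNat]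
    linear_combination hC
  rw [legendreNumerator, ← factorial_smul_hasseDeriv, LinearMap.smul_apply, eval_smul,
    ← taylor_coeff, h, coeff_mul_X_pow', if_pos le_rfl, Nat.sub_self, coeff_zero_eq_eval_zero]
  simp

theorem legendreNumerator_eval_sq_of_sq_eq_one (n : ℕ) {a : ℝ} (ha : a ^ 2 = 1) :
    (legendreNumerator n).eval a ^ 2 = (2 ^ n * n.factorial) ^ 2 := by
  rw [legendreNumerator_eval_of_sq_eq_one n ha, mul_pow 2 a, mul_pow, mul_pow, mul_pow,
    ← pow_mul a, mul_comm n 2, pow_mul, ha]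
  ring

theorem derivative_legendreNumerator_ne_zero {n : ℕ} (hn : 1 ≤ n) :
    Polynomial.derivative (legendreNumerator n) ≠ 0 := by
  intro h
  have h1 := congrArg (Polynomial.eval 1) (legendreNumerator_ode n)
  have h2 := legendreNumerator_eval_of_sq_eq_one n (one_pow 2 : (1 : ℝ) ^ 2 = 1)
  have h3 : 0 < (n.factorial : ℝ) * (2 * 1) ^ n := by positivity
  have hn' : 0 < (n : ℝ) := by exact_mod_cast hn
  rw [← h2] at h3
  have h4 : 0 < (n : ℝ) * (n + 1) * (legendreNumerator n).eval 1 := by positivity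
  simp [h] at h1
  rcases h1 with (h1 | h1) | h1
  · omega
  · linarith
  · linarith

open Polynomial in
theorem Polynomial.strictMonoOn_eval_of_derivative_nonneg {p : ℝ[X]} {a b : ℝ}
    (hp : derivative p ≠ 0) (h : ∀ x ∈ Set.Icc a b, 0 ≤ (derivative p).eval x) :
    StrictMonoOn (fun x => p.eval x) (Set.Icc a b) := by
  have hmono : MonotoneOn (fun x => p.eval x) (Set.Icc a b) :=
    monotoneOn_of_deriv_nonneg (convex_Icc a b) p.continuousOn p.differentiableOn
      fun x hx => by
        rw [Polynomial.deriv]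
        exact h x (interior_subset hx)
  intro x hx y hy hxy
  refine (hmono hx hy hxy.le).lt_of_ne fun heq => hp ?_
  have hconst : p = C (p.eval x) := by
    refine eq_of_infinite_eval_eq _ _ ((Set.Icc_infinite hxy).mono fun z hz => ?_)
    have hz' : z ∈ Set.Icc a b := ⟨hx.1.trans hz.1, hz.2.trans hy.2⟩
    have h1 := hmono hx hz' hz.1
    have h2 := hmono hz' hy hz.2
    simp only [Set.mem_ofPred_eq, eval_C]
    exact le_antisymm (h2.trans_eq heq.symm) h1
  rw [hconst, derivative_C]

open Polynomial in
/-- Sonin's function of the Legendre equation. -/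
noncomputable def legendreSonin (n : ℕ) : ℝ[X] :=
  (n : ℝ[X]) * ((n : ℝ[X]) + 1) * legendreNumerator n ^ 2 + (1 - X ^ 2) * derivative (legendreNumerator n) ^ 2

open Polynomial in
theorem derivative_legendreSonin (n : ℕ) :
    derivative (legendreSonin n) = 2 * X * derivative (legendreNumerator n) ^ 2 := by
  have h := legendreNumerator_ode n
  rw [legendreSonin]
  generalize legendreNumerator n = q at h ⊢
  simp [derivative_mul, derivative_pow, derivative_X, map_ofNat]
  linear_combination (-2 * derivative q) * h

theorem legendreSonin_eval_of_sq_eq_one (n : ℕ) {a : ℝ} (ha : a ^ 2 = 1) :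
    (legendreSonin n).eval a = n * (n + 1) * (2 ^ n * n.factorial) ^ 2 := by
  rw [← legendreNumerator_eval_sq_of_sq_eq_one n ha]
  simp [legendreSonin, ha]

theorem legendreSonin_eval_lt {n : ℕ} (hn : 1 ≤ n) {x : ℝ} (hx : |x| < 1) :
    (legendreSonin n).eval x < n * (n + 1) * (2 ^ n * n.factorial) ^ 2 := by
  obtain ⟨hx1, hx2⟩ := abs_lt.mp hx
  have hne : Polynomial.derivative (legendreSonin n) ≠ 0 := by
    rw [derivative_legendreSonin]
    exact mul_ne_zero (mul_ne_zero two_ne_zero Polynomial.X_ne_zero)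
      (pow_ne_zero 2 (derivative_legendreNumerator_ne_zero hn))
  rcases le_total 0 x with h0 | h0
  · rw [← legendreSonin_eval_of_sq_eq_one n (one_pow 2)]
    refine Polynomial.strictMonoOn_eval_of_derivative_nonneg (a := 0) (b := 1) hne
      (fun y hy => ?_) ⟨h0, hx2.le⟩ ⟨zero_le_one, le_rfl⟩ hx2
    have := hy.1
    simp only [derivative_legendreSonin, Polynomial.eval_mul, Polynomial.eval_ofNat,
      Polynomial.eval_X, Polynomial.eval_pow]
    positivity
  · rw [← legendreSonin_eval_of_sq_eq_one n (neg_one_sq)]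
    have key := Polynomial.strictMonoOn_eval_of_derivative_nonneg (p := -legendreSonin n)
      (a := -1) (b := 0) (by simpa using hne) (fun y hy => ?_)
      ⟨le_rfl, by norm_num⟩ ⟨hx1.le, h0⟩ hx1
    · simpa using key
    · simp only [derivative_legendreSonin, Polynomial.derivative_neg, Polynomial.eval_neg,
        Polynomial.eval_mul, Polynomial.eval_ofNat, Polynomial.eval_X, Polynomial.eval_pow]
      nlinarith [mul_nonneg (neg_nonneg.mpr hy.2)
        (sq_nonneg ((Polynomial.derivative (legendreNumerator n)).eval y))]

theorem abs_legendreP_of_sq_eq_one (n : ℕ) {a : ℝ} (ha : a ^ 2 = 1) : |legendreP n a| = 1 := by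
  have hpos : 0 < (2 ^ n * n.factorial : ℝ) := by positivity
  rw [legendreP_eq_eval, ← pow_eq_one_iff_of_nonneg (abs_nonneg _) two_ne_zero, sq_abs, div_pow,
    legendreNumerator_eval_sq_of_sq_eq_one n ha, div_self (by positivity)]

theorem abs_legendreP_lt_one {n : ℕ} (hn : 1 ≤ n) {x : ℝ} (hx : |x| < 1) :
    |legendreP n x| < 1 := by
  have hpos : 0 < (2 ^ n * n.factorial : ℝ) := by positivity
  have hn' : 0 < (n : ℝ) * (n + 1) := by
    have : 0 < (n : ℝ) := by exact_mod_cast hn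
    positivity
  have h := legendreSonin_eval_lt hn hx
  have hx' : 0 ≤ 1 - x ^ 2 := sub_nonneg.mpr ((sq_lt_one_iff_abs_lt_one x).mpr hx).le
  simp only [legendreSonin, Polynomial.eval_add, Polynomial.eval_mul, Polynomial.eval_natCast,
    Polynomial.eval_one, Polynomial.eval_pow, Polynomial.eval_sub, Polynomial.eval_X] at h
  have hsq : (legendreNumerator n).eval x ^ 2 < (2 ^ n * n.factorial) ^ 2 :=
    lt_of_mul_lt_mul_left (by
      linarith [mul_nonneg hx'
        (sq_nonneg ((Polynomial.derivative (legendreNumerator n)).eval x))]) hn'.le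
  rw [legendreP_eq_eval, abs_div, abs_of_pos hpos, div_lt_one hpos]
  exact abs_lt_of_sq_lt_sq hsq hpos.le

/-- Bound `|P_n(x)| ≤ 1` on `[-1,1]`, strict for `n ≥ 1` and `|x| < 1`. -/
theorem stmt_11 :
    (∀ n : ℕ, ∀ x ∈ Set.Icc (-1 : ℝ) 1, |legendreP n x| ≤ 1) ∧
    (∀ n : ℕ, 1 ≤ n → ∀ x : ℝ, |x| < 1 → |legendreP n x| < 1) := by
  refine ⟨fun n x hx => ?_, fun n hn x hx => abs_legendreP_lt_one hn hx⟩
  rcases Nat.eq_zero_or_pos n with rfl | hn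
  · simp [legendreP]
  rcases (abs_le.mpr hx).lt_or_eq with h | h
  · exact (abs_legendreP_lt_one hn h).le
  · exact (abs_legendreP_of_sq_eq_one n (by rw [← sq_abs, h, one_pow])).le
end

section
/- Fix real constants h₁ > 0, h₂ > 0, k ≥ 0 and y ∈ ℝ. For m large enough that ln(h₁ m) > 0 and b_m > 1, define b_m := √( ln(h₁ m) / h₂ ), c_m := (k/(2h₂)) ln b_m, and u_m := y/(2 h₂ b_m) + b_m − c_m / b_m. Then lim_{m→∞} h₁ · m · u_m^{−k} · exp( −h₂ u_m² ) = e^{−y}. -/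
open Filter

/-- The tail `exp (h x²) u ^ (-k) exp (-h u²)` at `u = y / (2 h x) + x - k log x / (2 h x)`,
rewritten so that its limit as `x → ∞` is visible. -/
theorem exp_mul_rpow_mul_exp_eq {h k y x u r : ℝ} (hh : 0 < h) (hx : 0 < x)
    (hu : u = y / (2 * h * x) + x - k / (2 * h) * Real.log x / x)
    (hr : r = (y / (2 * h) - k / (2 * h) * Real.log x) / x) (hpos : 0 < 1 + r / x) :
    Real.exp (h * x ^ 2) * u ^ (-k) * Real.exp (-h * u ^ 2) =
      Real.exp (-y - k * Real.log (1 + r / x) - h * r ^ 2) := by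
  have hrx : r * x = y / (2 * h) - k / (2 * h) * Real.log x := by
    rw [hr]; field_simp
  have hux : u = x * (1 + r / x) := by
    rw [hu, hr]; field_simp; ring
  have hsq : h * u ^ 2 = h * x ^ 2 + (y - k * Real.log x) + h * r ^ 2 := by
    have h2 : 2 * h * (r * x) = y - k * Real.log x := by
      rw [hrx]; field_simp
    have h3 : u = x + r := by rw [hux]; field_simp
    rw [h3, ← h2]; ring
  have hlog : Real.log u = Real.log x + Real.log (1 + r / x) := by
    rw [hux, Real.log_mul hx.ne' hpos.ne']
  have hupos : 0 < u := hux ▸ mul_pos hx hpos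
  rw [Real.rpow_def_of_pos hupos, ← Real.exp_add, ← Real.exp_add, neg_mul, hsq, hlog]
  congr 1
  ring

/-- The tail `exp (h x²) u ^ (-k) exp (-h u²)` at `u = y / (2 h x) + x - k log x / (2 h x)`
tends to `exp (-y)` as `x → ∞`. -/
theorem tendsto_exp_mul_rpow_mul_exp {h : ℝ} (hh : 0 < h) (k y : ℝ) :
    Tendsto (fun x : ℝ =>
      Real.exp (h * x ^ 2) *
        (y / (2 * h * x) + x - k / (2 * h) * Real.log x / x) ^ (-k) *
        Real.exp (-h * (y / (2 * h * x) + x - k / (2 * h) * Real.log x / x) ^ 2))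
      atTop (nhds (Real.exp (-y))) := by
  set r : ℝ → ℝ := fun x => (y / (2 * h) - k / (2 * h) * Real.log x) / x with hr
  have hr0 : Tendsto r atTop (nhds 0) := by
    have h1 : Tendsto (fun x : ℝ => Real.log x / x) atTop (nhds 0) :=
      Real.isLittleO_log_id_atTop.tendsto_div_nhds_zero
    have h2 : Tendsto (fun x : ℝ => y / (2 * h) / x) atTop (nhds 0) :=
      tendsto_const_nhds.div_atTop tendsto_id
    have h3 := h2.sub (h1.const_mul (k / (2 * h)))
    rw [mul_zero, sub_zero] at h3
    refine h3.congr fun x => ?_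
    simp only [hr]
    ring
  have hq : Tendsto (fun x => 1 + r x / x) atTop (nhds 1) := by
    simpa using (hr0.div_atTop tendsto_id).const_add 1
  have hlim : Tendsto (fun x => Real.exp (-y - k * Real.log (1 + r x / x) - h * r x ^ 2))
      atTop (nhds (Real.exp (-y))) := by
    have h1 := (hq.log one_ne_zero).const_mul k
    have h2 := (hr0.pow 2).const_mul h
    have h3 := ((h1.const_sub (-y)).sub h2).rexp
    simpa using h3
  refine hlim.congr' ?_
  filter_upwards [eventually_gt_atTop 0, hq.eventually (lt_mem_nhds one_pos)] with x hx hpos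
  exact (exp_mul_rpow_mul_exp_eq hh hx rfl rfl hpos).symm

/-- The normalizing sequence `u_m` turns the tail
`h₁ m u^{−k} exp(−h₂ u²)` into `e^{−y}` in the limit. -/
theorem stmt_19 (h₁ h₂ k y : ℝ) (hh₁ : 0 < h₁) (hh₂ : 0 < h₂) (hk : 0 ≤ k)
    (b c u : ℕ → ℝ)
    (hb : ∀ m : ℕ, b m = Real.sqrt (Real.log (h₁ * m) / h₂))
    (hc : ∀ m : ℕ, c m = (k / (2 * h₂)) * Real.log (b m))
    (hu : ∀ m : ℕ, u m = y / (2 * h₂ * b m) + b m - c m / b m) :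
    Tendsto (fun m : ℕ => h₁ * m * (u m) ^ (-k) * Real.exp (-h₂ * (u m) ^ 2))
      atTop (nhds (Real.exp (-y))) := by
  have hm : Tendsto (fun m : ℕ => h₁ * (m : ℝ)) atTop atTop :=
    tendsto_natCast_atTop_atTop.const_mul_atTop hh₁
  have hb_top : Tendsto b atTop atTop := by
    rw [funext hb]
    exact Real.tendsto_sqrt_atTop.comp
      ((Real.tendsto_log_atTop.comp hm).atTop_div_const hh₂)
  refine ((tendsto_exp_mul_rpow_mul_exp hh₂ k y).comp hb_top).congr' ?_
  filter_upwards [hm.eventually_ge_atTop 1] with m hm1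
  have hexp : Real.exp (h₂ * b m ^ 2) = h₁ * m := by
    rw [hb, Real.sq_sqrt (div_nonneg (Real.log_nonneg hm1) hh₂.le),
      mul_div_cancel₀ _ hh₂.ne', Real.exp_log (by linarith)]
  simp only [Function.comp_apply, hexp, hu, hc]
end
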